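/- Regularity of conformal mappings, smooth and real-analytic cases (Theorem 3.2, interior coordinate version): Let n ≥ 3. Let g and h be metrics on open sets U and V in ℝⁿ respectively, and let F : U → V be a C³ map with DF(x) invertible for every x ∈ U and DF(x)ᵀ h(F(x)) DF(x) = c(x) g(x) for all x ∈ U, where c : U → ℝ is a function. If g and h are C^∞, then F is C^∞ on U. If all entries of g and h are real-analytic, then F is real-analytic on U, and so is every C¹ local inverse of F. -/

import Mathlib

noncomputable section

open Set Matrix Matrix

/-- Points of `ℝⁿ`. -/
abbrev Pt (n : ℕ) := Fin n → ℝ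

/-- A metric in coordinates: a matrix-valued map. -/
abbrev Met (n : ℕ) := Pt n → Matrix (Fin n) (Fin n) ℝ

/-- Partial derivative of `f` in the `a`-th coordinate direction. -/
def pd {n : ℕ} (a : Fin n) (f : Pt n → ℝ) (x : Pt n) : ℝ :=
  fderiv ℝ f x (Pi.single a 1)

/-- `g` is a metric (pointwise symmetric positive definite) on `U`. -/
def IsMetricOn {n : ℕ} (g : Met n) (U : Set (Pt n)) : Prop :=
  ∀ x ∈ U, (g x).IsSymm ∧ (g x).PosDef

/-- Christoffel symbols `Γ^c_{ab}` of `g`. -/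
def christoffel {n : ℕ} (g : Met n) (c a b : Fin n) (x : Pt n) : ℝ :=
  (1 / 2) * ∑ d, (g x)⁻¹ c d *
    (pd a (fun y => g y b d) x + pd b (fun y => g y a d) x - pd d (fun y => g y a b) x)

/-- Ricci tensor `R_{ab}` of `g`. -/
def ricci {n : ℕ} (g : Met n) (a b : Fin n) (x : Pt n) : ℝ :=
  (∑ c, pd c (christoffel g c a b) x) - (∑ c, pd a (christoffel g c c b) x)
    + (∑ c, ∑ d, christoffel g c a b x * christoffel g d d c x)
    - (∑ c, ∑ d, christoffel g d c b x * christoffel g c a d x)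

/-- Scalar curvature `R(g)`. -/
def scalarCurv {n : ℕ} (g : Met n) (x : Pt n) : ℝ :=
  ∑ a, ∑ b, (g x)⁻¹ a b * ricci g a b x

/-- Laplace–Beltrami operator `Δ_g`. -/
def laplaceBeltrami {n : ℕ} (g : Met n) (u : Pt n → ℝ) (x : Pt n) : ℝ :=
  -(Real.sqrt (g x).det)⁻¹ *
    ∑ a, pd a (fun y => Real.sqrt (g y).det * ∑ b, (g y)⁻¹ a b * pd b u y) x

/-- Conformal Laplacian `L_g`. -/
def confLap {n : ℕ} (g : Met n) (u : Pt n → ℝ) (x : Pt n) : ℝ :=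
  laplaceBeltrami g u x + (((n : ℝ) - 2) / (4 * ((n : ℝ) - 1))) * scalarCurv g x * u x

/-- `f` is of class `C^{k+α}` on `s`: it is `C^k` there and its `k`-th order derivatives are
locally `α`-Hölder continuous. -/
def CHolderOn {n : ℕ} (k : ℕ) (α : ℝ) (s : Set (Pt n)) (f : Pt n → ℝ) : Prop :=
  ContDiffOn ℝ k f s ∧
    ∀ x ∈ s, ∃ C : NNReal, ∃ t ∈ nhdsWithin x s,
      HolderOnWith C (Real.toNNReal α) (iteratedFDerivWithin ℝ k f s) t

/-- All entries of `g` are of class `C^{k+α}` on `s`. -/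
def MetCHolderOn {n : ℕ} (k : ℕ) (α : ℝ) (s : Set (Pt n)) (g : Met n) : Prop :=
  ∀ a b, CHolderOn k α s fun x => g x a b

/-- Contracted Christoffel symbol `Γ^a = g^{bc} Γ^a_{bc}`. -/
def gammaUp {n : ℕ} (g : Met n) (a : Fin n) (x : Pt n) : ℝ :=
  ∑ b, ∑ c, (g x)⁻¹ b c * christoffel g a b c x

/-- Contracted Christoffel symbol `Γ_a = g_{ab} Γ^b`. -/
def gammaLow {n : ℕ} (g : Met n) (a : Fin n) (x : Pt n) : ℝ :=
  ∑ b, g x a b * gammaUp g b x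

/-- `g` satisfies the conformal harmonic gauge on `U`. -/
def ConfHarmonicGauge {n : ℕ} (g : Met n) (U : Set (Pt n)) : Prop :=
  ∃ f : Pt n → ℝ, ContDiffOn ℝ 2 f U ∧ (∀ x ∈ U, 0 < f x) ∧
    (∀ x ∈ U, confLap g f x = 0) ∧
    ∀ a : Fin n, ∀ x ∈ U, gammaLow g a x = 2 * pd a (fun y => Real.log (f y)) x

/-- Determinant-normalized metric `ĝ = (det g)^{-1/n} g`. -/
def dnorm {n : ℕ} (g : Met n) : Met n :=
  fun x => ((g x).det ^ (-(1 : ℝ) / (n : ℝ))) • g x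

/-- Jacobian matrix of a map `Z : ℝⁿ → ℝⁿ`. -/
def jac {n : ℕ} (Z : Pt n → Pt n) (x : Pt n) : Matrix (Fin n) (Fin n) ℝ :=
  Matrix.of fun i j => pd j (fun y => Z y i) x

/-- Riemann curvature tensor `R_{abc}{}^{d}`. -/
def riemannUp {n : ℕ} (g : Met n) (a b c d : Fin n) (x : Pt n) : ℝ :=
  pd a (christoffel g d b c) x - pd b (christoffel g d a c) x
    + (∑ e, christoffel g e b c x * christoffel g d a e x)
    - (∑ e, christoffel g e a c x * christoffel g d b e x)

/-- Riemann curvature tensor `R_{abcd} = R_{abc}{}^{e} g_{ed}`. -/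
def riemannLow {n : ℕ} (g : Met n) (a b c d : Fin n) (x : Pt n) : ℝ :=
  ∑ e, riemannUp g a b c e x * g x e d

/-- Schouten tensor `P_{ab}`. -/
def schouten {n : ℕ} (g : Met n) (a b : Fin n) (x : Pt n) : ℝ :=
  (1 / ((n : ℝ) - 2)) * (ricci g a b x - (scalarCurv g x / (2 * ((n : ℝ) - 1))) * g x a b)

/-- Weyl tensor `W_{abcd}`. -/
def weyl {n : ℕ} (g : Met n) (a b c d : Fin n) (x : Pt n) : ℝ :=
  riemannLow g a b c d x + schouten g a c x * g x b d - schouten g b c x * g x a d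
    + schouten g b d x * g x a c - schouten g a d x * g x b c

/-- Weyl tensor with raised last index, `W_{abc}{}^{d} = g^{de} W_{abce}`. -/
def weylUp {n : ℕ} (g : Met n) (a b c d : Fin n) (x : Pt n) : ℝ :=
  ∑ e, (g x)⁻¹ d e * weyl g a b c e x

/-- Covariant derivative of a 2-tensor: `(∇T)_{cab} = ∇_c T_{ab}`. -/
def cov2 {n : ℕ} (g : Met n) (T : Fin n → Fin n → Pt n → ℝ) (c a b : Fin n) (x : Pt n) : ℝ :=
  pd c (T a b) x - (∑ d, christoffel g d c a x * T d b x)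
    - ∑ d, christoffel g d c b x * T a d x

/-- Covariant derivative of a 3-tensor: `(∇T)_{dabc} = ∇_d T_{abc}`. -/
def cov3 {n : ℕ} (g : Met n) (T : Fin n → Fin n → Fin n → Pt n → ℝ) (d a b c : Fin n)
    (x : Pt n) : ℝ :=
  pd d (T a b c) x - (∑ e, christoffel g e d a x * T e b c x)
    - (∑ e, christoffel g e d b x * T a e c x)
    - ∑ e, christoffel g e d c x * T a b e x

/-- Cotton tensor `C_{abc} = ∇_a P_{bc} - ∇_b P_{ac}`. -/
def cotton {n : ℕ} (g : Met n) (a b c : Fin n) (x : Pt n) : ℝ :=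
  cov2 g (schouten g) a b c x - cov2 g (schouten g) b a c x

/-- Bach tensor `B_{ab}`. -/
def bach {n : ℕ} (g : Met n) (a b : Fin n) (x : Pt n) : ℝ :=
  (∑ c, ∑ d, (g x)⁻¹ c d *
      (cov3 g (cov2 g (schouten g)) d a b c x - cov3 g (cov2 g (schouten g)) d c a b x))
    + ∑ c, ∑ d, ∑ e, ∑ f, (g x)⁻¹ c e * (g x)⁻¹ d f * schouten g e f x * weyl g a c d b x

open scoped ContDiff Topology

namespace ContinuousMap

variable {K X Y : Type*} [TopologicalSpace K] [CompactSpace K]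
  [NormedAddCommGroup X] [NormedSpace ℝ X] [NormedAddCommGroup Y] [NormedSpace ℝ Y]

/-- The pointwise action of a continuous multilinear map on continuous functions. -/
def liftMultilinear {k : ℕ} (p : X [×k]→L[ℝ] Y) : C(K, X) [×k]→L[ℝ] C(K, Y) :=
  MultilinearMap.mkContinuous
    { toFun := fun v => ⟨fun t => p fun i => v i t, by fun_prop⟩
      map_update_add' := by
        intro _ m i x y
        ext t
        have h : ∀ z : C(K, X), (fun j => (Function.update m i z) j t) =
            Function.update (fun j => m j t) i (z t) := by
          intro z; ext j; by_cases hj : j = i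
          · subst hj; simp
          · simp [hj]
        simp [h]
      map_update_smul' := by
        intro _ m i r x
        ext t
        have h : ∀ z : C(K, X), (fun j => (Function.update m i z) j t) =
            Function.update (fun j => m j t) i (z t) := by
          intro z; ext j; by_cases hj : j = i
          · subst hj; simp
          · simp [hj]
        simp [h] }
    ‖p‖ (by
      intro m
      rw [ContinuousMap.norm_le _ (by positivity)]
      intro t
      refine (p.le_opNorm _).trans ?_
      gcongr with i
      exact (m i).norm_coe_le_norm t)

theorem norm_liftMultilinear_le {k : ℕ} (p : X [×k]→L[ℝ] Y) :
    ‖(liftMultilinear p : C(K, X) [×k]→L[ℝ] C(K, Y))‖ ≤ ‖p‖ :=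
  MultilinearMap.mkContinuous_norm_le _ (norm_nonneg _) _

/-- The superposition operator of an analytic function is analytic on continuous functions. -/
theorem exists_analyticAt_superposition [CompleteSpace Y] {f : X → Y} {x₀ : X}
    (hf : AnalyticAt ℝ f x₀) :
    ∃ N : C(K, X) → C(K, Y), AnalyticAt ℝ N 0 ∧
      ∀ᶠ v in 𝓝 (0 : C(K, X)), ∀ t, N v t = f (x₀ + v t) := by
  obtain ⟨p, r, hp⟩ := hf
  let P : FormalMultilinearSeries ℝ C(K, X) C(K, Y) := fun k => liftMultilinear (p k)
  have hrad : p.radius ≤ P.radius := by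
    refine FormalMultilinearSeries.radius_le_of_le fun {k} => ?_
    exact norm_liftMultilinear_le _
  have hpos : 0 < P.radius := (hp.r_pos.trans_le hp.r_le).trans_le hrad
  have hP := P.hasFPowerSeriesOnBall hpos
  refine ⟨P.sum, ⟨P, P.radius, hP⟩, ?_⟩
  have hball : Metric.eball (0 : C(K, X)) r ∈ 𝓝 0 := Metric.eball_mem_nhds _ hp.r_pos
  filter_upwards [hball] with v hv t
  have hs : HasSum (fun k => P k fun _ => v) (P.sum v) := by
    have := hP.hasSum (y := v) (Metric.eball_subset_eball (hp.r_le.trans hrad) hv)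
    simpa using this
  have h1 := (ContinuousMap.hasSum_apply hs t)
  have hvt : v t ∈ Metric.eball (0 : X) r := by
    have : ‖v t‖ ≤ ‖v‖ := v.norm_coe_le_norm t
    simp only [Metric.mem_eball, edist_zero_right] at hv ⊢
    exact (enorm_le_iff_norm_le.mpr this).trans_lt hv
  exact h1.unique (hp.hasSum hvt)

end ContinuousMap

section Primitive

variable {X : Type*} [NormedAddCommGroup X] [NormedSpace ℝ X]

/-- The primitive vanishing at `0`, as an operator on continuous functions on `[0, 1]`. -/
def primitiveCLM : C(unitInterval, X) →L[ℝ] C(unitInterval, X) :=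
  LinearMap.mkContinuous
    { toFun := fun w => ⟨fun s => ∫ τ in (0 : ℝ)..s, w (projIcc 0 1 zero_le_one τ), by
        have h : Continuous fun τ : ℝ => w (projIcc 0 1 zero_le_one τ) := by
          fun_prop
        exact (intervalIntegral.continuous_primitive
          (fun a b => h.intervalIntegrable a b) 0).comp continuous_subtype_val⟩
      map_add' := by
        intro v w
        ext s
        exact intervalIntegral.integral_add
          (Continuous.intervalIntegrable (by fun_prop) _ _)
          (Continuous.intervalIntegrable (by fun_prop) _ _)
      map_smul' := by
        intro r w
        ext s
        exact intervalIntegral.integral_smul _ _ }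
    1 (by
      intro w
      rw [ContinuousMap.norm_le _ (by positivity)]
      intro s
      refine (intervalIntegral.norm_integral_le_of_norm_le_const (C := ‖w‖)
        fun τ _ => w.norm_coe_le_norm _).trans ?_
      rw [one_mul, sub_zero, abs_of_nonneg s.2.1]
      exact mul_le_of_le_one_right (norm_nonneg _) s.2.2)

theorem primitiveCLM_apply (w : C(unitInterval, X)) (s : unitInterval) :
    primitiveCLM w s = ∫ τ in (0 : ℝ)..s, w (projIcc 0 1 zero_le_one τ) := rfl

end Primitive

/-- The linear map sending `(y, w)` to the path `s ↦ (s • y, w s, y)`. -/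
def rayPathCLM (E X : Type*) [NormedAddCommGroup E] [NormedSpace ℝ E]
    [NormedAddCommGroup X] [NormedSpace ℝ X] :
    E × C(unitInterval, X) →L[ℝ] C(unitInterval, E × X × E) :=
  LinearMap.mkContinuous
    { toFun := fun z => ⟨fun s => ((s : ℝ) • z.1, z.2 s, z.1), by fun_prop⟩
      map_add' := by intro z z'; ext s <;> simp
      map_smul' := by intro r z; ext s <;> simp [smul_comm (s : ℝ) r] }
    1 (by
      intro z
      rw [ContinuousMap.norm_le _ (by positivity), one_mul]
      intro s
      have h1 : ‖(s : ℝ) • z.1‖ ≤ ‖z‖ := by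
        rw [norm_smul, Real.norm_of_nonneg s.2.1]
        exact (mul_le_of_le_one_left (norm_nonneg _) s.2.2).trans (norm_fst_le z)
      have h2 : ‖z.2 s‖ ≤ ‖z‖ := (z.2.norm_coe_le_norm s).trans (norm_snd_le z)
      exact norm_prod_le_iff.mpr ⟨h1, norm_prod_le_iff.mpr ⟨h2, norm_fst_le z⟩⟩)

theorem rayPathCLM_apply {E X : Type*} [NormedAddCommGroup E] [NormedSpace ℝ E]
    [NormedAddCommGroup X] [NormedSpace ℝ X] (y : E) (w : C(unitInterval, X))
    (s : unitInterval) : rayPathCLM E X (y, w) s = ((s : ℝ) • y, w s, y) := rfl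

section TotalDifferential

variable {E X : Type*} [NormedAddCommGroup E] [NormedSpace ℝ E]
    [NormedAddCommGroup X] [NormedSpace ℝ X]

/-- Solutions of an analytic total differential equation are analytic. -/
theorem contDiffAt_omega_of_hasFDerivAt_eq [CompleteSpace E] [CompleteSpace X] {u : E → X} {x₀ : E}
    {Φ : E × X → E →L[ℝ] X} (hΦ : ContDiffAt ℝ ω Φ (x₀, u x₀))
    (hu : ∀ᶠ x in 𝓝 x₀, HasFDerivAt u (Φ (x, u x)) x) : ContDiffAt ℝ ω u x₀ := by
  let f : E × X × E → X := fun z => Φ ((x₀, u x₀) + (z.1, z.2.1)) z.2.2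
  have hf : AnalyticAt ℝ f 0 := by
    have h1 : ContDiffAt ℝ ω (fun z : E × X × E => Φ ((x₀, u x₀) + (z.1, z.2.1))) 0 := by
      refine ContDiffAt.comp (g := Φ) (f := fun z : E × X × E => (x₀, u x₀) + (z.1, z.2.1))
        0 (by simpa using hΦ) (by fun_prop)
    exact ContDiffAt.analyticAt (h1.clm_apply (by fun_prop))
  obtain ⟨N, hN, hNf⟩ := ContinuousMap.exists_analyticAt_superposition (K := unitInterval) hf
  let L := rayPathCLM E X
  let Ψ : E × C(unitInterval, X) → C(unitInterval, X) := fun z => z.2 - primitiveCLM (N (L z))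
  have hNL : ContDiffAt ℝ ω (fun z => N (L z)) 0 := by
    refine ContDiffAt.comp (g := N) (f := L) 0 ?_ L.contDiff.contDiffAt
    rw [map_zero]
    exact hN.contDiffAt
  have hTNL : ContDiffAt ℝ ω (fun z => primitiveCLM (N (L z))) 0 :=
    ContDiffAt.continuousLinearMap_comp (primitiveCLM (X := X)) hNL
  have hΨ : ContDiffAt ℝ ω Ψ 0 :=
    contDiff_snd.contDiffAt.sub hTNL
  have hLt : Filter.Tendsto L (𝓝 0) (𝓝 0) := by
    simpa using L.continuous.tendsto 0
  have hΨ0 : ∀ᶠ w in 𝓝 (0 : C(unitInterval, X)), Ψ (0, w) = w := by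
    have ht : Filter.Tendsto (fun w : C(unitInterval, X) => L (0, w)) (𝓝 0) (𝓝 0) :=
      hLt.comp (Continuous.tendsto' (by fun_prop) _ _ rfl)
    filter_upwards [ht.eventually hNf] with w hw
    have : N (L (0, w)) = 0 := by
      ext s
      rw [hw s]
      simp [f, L, rayPathCLM_apply]
    simp [Ψ, this]
  have hder : fderiv ℝ Ψ 0 ∘L .inr ℝ E C(unitInterval, X) = .id ℝ _ := by
    have h1 : HasFDerivAt (fun w : C(unitInterval, X) => Ψ (0, w))
        (fderiv ℝ Ψ 0 ∘L .inr ℝ E C(unitInterval, X)) 0 := by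
      have h2 : HasFDerivAt Ψ (fderiv ℝ Ψ 0) ((0 : E), (0 : C(unitInterval, X))) :=
        (hΨ.differentiableAt (by simp)).hasFDerivAt
      exact h2.comp (0 : C(unitInterval, X)) (hasFDerivAt_prodMk_right (0 : E) (0 : C(unitInterval, X)))
    have h3 : HasFDerivAt (fun w : C(unitInterval, X) => Ψ (0, w)) (.id ℝ _) 0 :=
      (hasFDerivAt_id _).congr_of_eventuallyEq hΨ0
    exact h1.unique h3
  have hinv : (fderiv ℝ Ψ 0 ∘L .inr ℝ E C(unitInterval, X)).IsInvertible := by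
    rw [hder]; exact ContinuousLinearMap.isInvertible_equiv (f := .refl ℝ _)
  have himp := hΨ.eventually_apply_eq_iff_implicitFunction (by simp) hinv
  set G := hΨ.implicitFunction (by simp) hinv with hG
  have hGd : ContDiffAt ℝ ω G 0 := hΨ.contDiffAt_implicitFunction (by simp) hinv
  have hΨz : Ψ 0 = 0 := hΨ0.self_of_nhds
  rw [hΨz] at himp
  obtain ⟨δ, hδ, hball⟩ := Metric.eventually_nhds_iff.mp (himp.and (hLt.eventually hNf))
  have hu0 := hu.self_of_nhds.continuousAt
  obtain ⟨ρ, hρ, hball'⟩ := Metric.eventually_nhds_iff.mp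
    (hu.and (hu0.eventually (Metric.ball_mem_nhds (u x₀) (half_pos hδ))))
  have hray : ∀ y : E, ‖y‖ < ρ → ∀ s ∈ Icc (0 : ℝ) 1, dist (x₀ + s • y) x₀ < ρ := by
    intro y hy s hs
    rw [dist_eq_norm, add_sub_cancel_left, norm_smul, Real.norm_of_nonneg hs.1]
    exact (mul_le_of_le_one_left (norm_nonneg _) hs.2).trans_lt hy
  have key : ∀ᶠ y in 𝓝 (0 : E), u (x₀ + y) = u x₀ + G y 1 := by
    filter_upwards [Metric.ball_mem_nhds (0 : E) (lt_min hρ hδ)] with y hy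
    rw [mem_ball_zero_iff, lt_min_iff] at hy
    have hd : ∀ s ∈ Icc (0 : ℝ) 1, HasDerivAt (fun s : ℝ => u (x₀ + s • y))
        (Φ (x₀ + s • y, u (x₀ + s • y)) y) s := by
      intro s hs
      have h1 := (hball' (hray y hy.1 s hs)).1
      have h2 : HasDerivAt (fun s : ℝ => x₀ + s • y) y s := by
        simpa using ((hasDerivAt_id s).smul_const y).const_add x₀
      exact h1.comp_hasDerivAt s h2
    let w : C(unitInterval, X) := ⟨fun s => u (x₀ + (s : ℝ) • y) - u x₀, by
      refine Continuous.sub ?_ continuous_const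
      rw [continuous_iff_continuousAt]
      intro s
      exact (hd s s.2).continuousAt.comp continuous_subtype_val.continuousAt⟩
    have hwn : ‖w‖ < δ := by
      refine lt_of_le_of_lt ((ContinuousMap.norm_le _ (half_pos hδ).le).mpr fun s => ?_)
        (half_lt_self hδ)
      simpa [w, dist_eq_norm] using (hball' (hray y hy.1 s s.2)).2.le
    have hz : dist (y, w) 0 < δ := by
      rw [dist_zero_right]
      exact max_lt hy.2 hwn
    obtain ⟨h1, h2⟩ := hball hz
    have hΨw : Ψ (y, w) = 0 := by
      ext s
      have h3 : ∀ τ ∈ uIcc (0 : ℝ) s, N (L (y, w)) (projIcc 0 1 zero_le_one τ) =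
          Φ (x₀ + τ • y, u (x₀ + τ • y)) y := by
        intro τ hτ
        rw [uIcc_of_le s.2.1] at hτ
        rw [projIcc_of_mem zero_le_one ⟨hτ.1, hτ.2.trans s.2.2⟩, h2]
        simp [f, L, rayPathCLM_apply, w]
      have h4 : primitiveCLM (N (L (y, w))) s = u (x₀ + (s : ℝ) • y) - u (x₀ + (0 : ℝ) • y) := by
        rw [primitiveCLM_apply]
        refine intervalIntegral.integral_eq_sub_of_hasDerivAt
          (f := fun s : ℝ => u (x₀ + s • y)) (fun τ hτ => ?_)
          (Continuous.intervalIntegrable (by fun_prop) _ _)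
        rw [h3 τ hτ]
        rw [uIcc_of_le s.2.1] at hτ
        exact hd τ ⟨hτ.1, hτ.2.trans s.2.2⟩
      simp only [Ψ, ContinuousMap.sub_apply, h4]
      simp [w]
    have h5 : G y = w := h1.mp hΨw
    rw [h5]
    simp [w]
  have hfin : ContDiffAt ℝ ω (fun x => u x₀ + G (x - x₀) 1) x₀ := by
    have h1 : ContDiffAt ℝ ω (fun x => G (x - x₀)) x₀ :=
      ContDiffAt.comp (g := G) x₀ (by simpa using hGd) (by fun_prop)
    have h2 : ContDiffAt ℝ ω (fun x => G (x - x₀) 1) x₀ :=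
      ContDiffAt.continuousLinearMap_comp
        (ContinuousMap.evalCLM ℝ (1 : unitInterval) : C(unitInterval, X) →L[ℝ] X) h1
    exact contDiffAt_const.add h2
  refine hfin.congr_of_eventuallyEq ?_
  have ht : Filter.Tendsto (fun x => x - x₀) (𝓝 x₀) (𝓝 0) :=
    Continuous.tendsto' (by fun_prop) _ _ (sub_self _)
  filter_upwards [ht.eventually key] with x hx
  simpa using hx

/-- Solutions of a smooth total differential equation are smooth. -/
theorem contDiffAt_infty_of_hasFDerivAt_eq {u : E → X} {x₀ : E}
    {Φ : E × X → E →L[ℝ] X} (hΦ : ContDiffAt ℝ ∞ Φ (x₀, u x₀))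
    (hu : ∀ᶠ x in 𝓝 x₀, HasFDerivAt u (Φ (x, u x)) x) : ContDiffAt ℝ ∞ u x₀ := by
  rw [contDiffAt_infty]
  intro k
  induction k with
  | zero =>
    rw [Nat.cast_zero, contDiffAt_zero]
    exact ⟨_, hu, fun x hx => hx.continuousAt.continuousWithinAt⟩
  | succ k ih =>
    rw [Nat.cast_add, Nat.cast_one, contDiffAt_succ_iff_hasFDerivAt]
    refine ⟨fun x => Φ (x, u x), ⟨_, hu, fun x hx => hx⟩, ?_⟩
    exact (hΦ.of_le (by exact_mod_cast le_top)).comp x₀ (contDiffAt_id.prodMk ih)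

end TotalDifferential

section PartialDerivatives

variable {n : ℕ}

theorem pd_congr {f g : Pt n → ℝ} {x : Pt n} (h : f =ᶠ[𝓝 x] g) (a : Fin n) :
    pd a f =ᶠ[𝓝 x] pd a g :=
  (Filter.EventuallyEq.fderiv (𝕜 := ℝ) h).mono fun y hy => by simp only [pd, hy]

theorem contDiffAt_pd {f : Pt n → ℝ} {x : Pt n} {k l : WithTop ℕ∞} (hf : ContDiffAt ℝ l f x)
    (hk : k + 1 ≤ l) (a : Fin n) : ContDiffAt ℝ k (pd a f) x :=
  (hf.fderiv_right hk).clm_apply contDiffAt_const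

theorem pd_add {f g : Pt n → ℝ} {x : Pt n} (hf : DifferentiableAt ℝ f x)
    (hg : DifferentiableAt ℝ g x) (a : Fin n) :
    pd a (fun y => f y + g y) x = pd a f x + pd a g x := by
  simp [pd, fderiv_fun_add hf hg]

theorem pd_mul {f g : Pt n → ℝ} {x : Pt n} (hf : DifferentiableAt ℝ f x)
    (hg : DifferentiableAt ℝ g x) (a : Fin n) :
    pd a (fun y => f y * g y) x = pd a f x * g x + f x * pd a g x := by
  simp [pd, fderiv_fun_mul hf hg]
  ring

theorem pd_sum {ι : Type*} (s : Finset ι) {f : ι → Pt n → ℝ} {x : Pt n}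
    (hf : ∀ i ∈ s, DifferentiableAt ℝ (f i) x) (a : Fin n) :
    pd a (fun y => ∑ i ∈ s, f i y) x = ∑ i ∈ s, pd a (f i) x := by
  simp [pd, fderiv_fun_sum hf]

theorem pd_inv {f : Pt n → ℝ} {x : Pt n} (hf : DifferentiableAt ℝ f x) (h0 : f x ≠ 0)
    (a : Fin n) : pd a (fun y => (f y)⁻¹) x = -pd a f x * ((f x)⁻¹ * (f x)⁻¹) := by
  have h := (hasDerivAt_inv h0).comp_hasFDerivAt x hf.hasFDerivAt
  simp only [Function.comp_def] at h
  simp only [pd, h.fderiv]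
  simp
  field_simp

theorem pd_comp {K : Pt n → ℝ} {F : Pt n → Pt n} {x : Pt n}
    (hK : DifferentiableAt ℝ K (F x)) (hF : DifferentiableAt ℝ F x) (a : Fin n) :
    pd a (fun y => K (F y)) x = ∑ l, pd l K (F x) * pd a (fun y => F y l) x := by
  have h : fderiv ℝ (fun y => K (F y)) x = (fderiv ℝ K (F x)).comp (fderiv ℝ F x) :=
    fderiv_comp x hK hF
  have hv : ∀ v : Pt n, fderiv ℝ K (F x) v = ∑ l, pd l K (F x) * v l := by
    intro v
    conv_lhs => rw [pi_eq_sum_univ' v]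
    simp [pd, mul_comm]
  have hc : ∀ l, fderiv ℝ F x (Pi.single a 1) l = pd a (fun y => F y l) x := by
    intro l
    rw [pd, (hasFDerivAt_pi'.mp hF.hasFDerivAt l).fderiv]
    rfl
  simp only [pd, h, ContinuousLinearMap.comp_apply]
  rw [hv]
  simp only [hc, pd]

theorem pd_comm {f : Pt n → ℝ} {x : Pt n} (hf : ContDiffAt ℝ 2 f x) (a b : Fin n) :
    pd a (pd b f) x = pd b (pd a f) x := by
  have hd : DifferentiableAt ℝ (fderiv ℝ f) x :=
    (hf.fderiv_right (m := 1) (by norm_num)).differentiableAt (by simp)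
  have h : ∀ a b : Fin n, pd a (pd b f) x =
      fderiv ℝ (fderiv ℝ f) x (Pi.single a 1) (Pi.single b 1) := by
    intro a b
    have := (hd.hasFDerivAt.clm_apply (hasFDerivAt_const (Pi.single b (1 : ℝ)) x)).fderiv
    unfold pd
    rw [this]
    simp
  rw [h, h]
  exact (hf.isSymmSndFDerivAt (by simp)) _ _

theorem pd_pd_mul {f g : Pt n → ℝ} {x : Pt n} (hf : ContDiffAt ℝ 2 f x)
    (hg : ContDiffAt ℝ 2 g x) (d e : Fin n) :
    pd e (pd d fun y => f y * g y) x = pd e (pd d f) x * g x + pd d f x * pd e g x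
      + (pd e f x * pd d g x + f x * pd e (pd d g) x) := by
  have h1 : pd d (fun y => f y * g y) =ᶠ[𝓝 x] fun y => pd d f y * g y + f y * pd d g y := by
    filter_upwards [hf.eventually (by simp), hg.eventually (by simp)] with y hfy hgy
    exact pd_mul (hfy.differentiableAt (by simp)) (hgy.differentiableAt (by simp)) d
  have hfd := hf.differentiableAt (by simp)
  have hgd := hg.differentiableAt (by simp)
  have hpf := (contDiffAt_pd (k := 1) hf (by norm_num) d).differentiableAt (by simp)
  have hpg := (contDiffAt_pd (k := 1) hg (by norm_num) d).differentiableAt (by simp)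
  rw [(pd_congr h1 e).self_of_nhds, pd_add (hpf.fun_mul hgd) (hfd.fun_mul hpg), pd_mul hpf hgd,
    pd_mul hfd hpg]

theorem pd_pd_sum {ι : Type*} (s : Finset ι) {f : ι → Pt n → ℝ} {x : Pt n}
    (hf : ∀ i ∈ s, ContDiffAt ℝ 2 (f i) x) (d e : Fin n) :
    pd e (pd d fun y => ∑ i ∈ s, f i y) x = ∑ i ∈ s, pd e (pd d (f i)) x := by
  have h1 : pd d (fun y => ∑ i ∈ s, f i y) =ᶠ[𝓝 x] fun y => ∑ i ∈ s, pd d (f i) y := by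
    have : ∀ᶠ y in 𝓝 x, ∀ i ∈ s, ContDiffAt ℝ 2 (f i) y :=
      (Filter.eventually_all_finset s).mpr fun i hi => (hf i hi).eventually (by simp)
    filter_upwards [this] with y hy
    exact pd_sum s (fun i hi => (hy i hi).differentiableAt (by simp)) d
  rw [(pd_congr h1 e).self_of_nhds, pd_sum s fun i hi =>
    (contDiffAt_pd (k := 1) (hf i hi) (by norm_num) d).differentiableAt (by simp)]

end PartialDerivatives

section JetRing

variable {n : ℕ} {X : Type*} [NormedAddCommGroup X] [NormedSpace ℝ X]

/-- The functions that near `x₀` are `C^m` expressions in `x` and `u x`. -/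
def jetRing (m : WithTop ℕ∞) (u : Pt n → X) (x₀ : Pt n) : Subalgebra ℝ (Pt n → ℝ) where
  carrier := {f | ∃ Ψ : Pt n × X → ℝ, ContDiffAt ℝ m Ψ (x₀, u x₀) ∧
    f =ᶠ[𝓝 x₀] fun x => Ψ (x, u x)}
  mul_mem' := by
    rintro f g ⟨Φ, hΦ, hf⟩ ⟨Ψ, hΨ, hg⟩
    exact ⟨_, hΦ.mul hΨ, hf.mul hg⟩
  add_mem' := by
    rintro f g ⟨Φ, hΦ, hf⟩ ⟨Ψ, hΨ, hg⟩
    exact ⟨_, hΦ.add hΨ, hf.add hg⟩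
  algebraMap_mem' := fun r => ⟨fun _ => r, contDiffAt_const, .rfl⟩

variable {m : WithTop ℕ∞} {u : Pt n → X} {x₀ : Pt n}

theorem mem_jetRing {f : Pt n → ℝ} : f ∈ jetRing m u x₀ ↔
    ∃ Ψ : Pt n × X → ℝ, ContDiffAt ℝ m Ψ (x₀, u x₀) ∧ f =ᶠ[𝓝 x₀] fun x => Ψ (x, u x) :=
  Iff.rfl

namespace jetRing

theorem congr_mem {f g : Pt n → ℝ} (hg : g ∈ jetRing m u x₀) (h : f =ᶠ[𝓝 x₀] g) :
    f ∈ jetRing m u x₀ := by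
  obtain ⟨Ψ, hΨ, hg⟩ := hg
  exact ⟨Ψ, hΨ, h.trans hg⟩

theorem comp_mem {Ψ : Pt n × X → ℝ} (hΨ : ContDiffAt ℝ m Ψ (x₀, u x₀)) :
    (fun x => Ψ (x, u x)) ∈ jetRing m u x₀ :=
  ⟨Ψ, hΨ, .rfl⟩

theorem of_contDiffAt {f : Pt n → ℝ} (hf : ContDiffAt ℝ m f x₀) : f ∈ jetRing m u x₀ :=
  comp_mem (Ψ := fun z => f z.1) (ContDiffAt.comp (g := f) (x₀, u x₀) hf contDiffAt_fst)

theorem inv_mem {f : Pt n → ℝ} (hf : f ∈ jetRing m u x₀) (h0 : f x₀ ≠ 0) :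
    (fun x => (f x)⁻¹) ∈ jetRing m u x₀ := by
  obtain ⟨Ψ, hΨ, hf⟩ := hf
  refine ⟨fun z => (Ψ z)⁻¹, hΨ.inv ?_, hf.fun_comp _⟩
  rwa [← show f x₀ = Ψ (x₀, u x₀) from hf.self_of_nhds]

theorem fun_mul_mem {f g : Pt n → ℝ} (hf : f ∈ jetRing m u x₀) (hg : g ∈ jetRing m u x₀) :
    (fun x => f x * g x) ∈ jetRing m u x₀ :=
  mul_mem hf hg

theorem fun_add_mem {f g : Pt n → ℝ} (hf : f ∈ jetRing m u x₀) (hg : g ∈ jetRing m u x₀) :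
    (fun x => f x + g x) ∈ jetRing m u x₀ :=
  add_mem hf hg

theorem fun_sub_mem {f g : Pt n → ℝ} (hf : f ∈ jetRing m u x₀) (hg : g ∈ jetRing m u x₀) :
    (fun x => f x - g x) ∈ jetRing m u x₀ :=
  sub_mem hf hg

theorem const_mem (r : ℝ) : (fun _ => r) ∈ jetRing m u x₀ :=
  (jetRing m u x₀).algebraMap_mem r

theorem fun_sum_mem {ι : Type*} (s : Finset ι) {f : ι → Pt n → ℝ}
    (hf : ∀ i ∈ s, f i ∈ jetRing m u x₀) : (fun x => ∑ i ∈ s, f i x) ∈ jetRing m u x₀ := by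
  have := sum_mem hf
  convert this using 1
  ext x
  simp

theorem fun_prod_mem {ι : Type*} (s : Finset ι) {f : ι → Pt n → ℝ}
    (hf : ∀ i ∈ s, f i ∈ jetRing m u x₀) : (fun x => ∏ i ∈ s, f i x) ∈ jetRing m u x₀ := by
  have := prod_mem hf
  convert this using 1
  ext x
  simp

theorem det_mem {k : ℕ} {M : Pt n → Matrix (Fin k) (Fin k) ℝ}
    (hM : ∀ i j, (fun x => M x i j) ∈ jetRing m u x₀) :
    (fun x => (M x).det) ∈ jetRing m u x₀ := by
  simp only [Matrix.det_apply']
  exact fun_sum_mem _ fun σ _ => fun_mul_mem (const_mem _) (fun_prod_mem _ fun i _ => hM _ _)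

theorem matrix_inv_mem {k : ℕ} {M : Pt n → Matrix (Fin k) (Fin k) ℝ}
    (hM : ∀ i j, (fun x => M x i j) ∈ jetRing m u x₀) (h0 : (M x₀).det ≠ 0) (i j : Fin k) :
    (fun x => (M x)⁻¹ i j) ∈ jetRing m u x₀ := by
  simp only [Matrix.inv_def, Ring.inverse_eq_inv', Matrix.smul_apply, smul_eq_mul,
    Matrix.adjugate_apply]
  refine fun_mul_mem (inv_mem (det_mem hM) h0) (det_mem fun a b => ?_)
  by_cases h : a = j
  · subst h
    simpa using const_mem _
  · simpa [Matrix.updateRow_ne h] using hM a b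

end jetRing

/-- A `C²` function that belongs to the jet ring together with its first derivatives. -/
structure IsJetC2 (m : WithTop ℕ∞) (u : Pt n → X) (x₀ : Pt n) (f : Pt n → ℝ) : Prop where
  contDiffAt : ContDiffAt ℝ 2 f x₀
  mem : f ∈ jetRing m u x₀
  pd_mem : ∀ d, pd d f ∈ jetRing m u x₀

namespace IsJetC2

open jetRing

theorem eventually_differentiableAt {f : Pt n → ℝ} (hf : IsJetC2 m u x₀ f) :
    ∀ᶠ x in 𝓝 x₀, DifferentiableAt ℝ f x :=
  (hf.contDiffAt.eventually (by simp)).mono fun _ h => h.differentiableAt (by simp)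

theorem of_contDiffAt {f : Pt n → ℝ} (hf : ContDiffAt ℝ m f x₀) (hm : m + 1 ≤ m) (h2 : 2 ≤ m) :
    IsJetC2 m u x₀ f :=
  ⟨hf.of_le h2, jetRing.of_contDiffAt hf, fun d => jetRing.of_contDiffAt (contDiffAt_pd hf hm d)⟩

theorem mul {f g : Pt n → ℝ} (hf : IsJetC2 m u x₀ f) (hg : IsJetC2 m u x₀ g) :
    IsJetC2 m u x₀ fun x => f x * g x where
  contDiffAt := hf.contDiffAt.mul hg.contDiffAt
  mem := fun_mul_mem hf.mem hg.mem
  pd_mem d := by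
    refine congr_mem (fun_add_mem (fun_mul_mem (hf.pd_mem d) hg.mem)
      (fun_mul_mem hf.mem (hg.pd_mem d))) ?_
    filter_upwards [hf.eventually_differentiableAt, hg.eventually_differentiableAt] with x h1 h2
    exact pd_mul h1 h2 d

theorem inv {f : Pt n → ℝ} (hf : IsJetC2 m u x₀ f) (h0 : f x₀ ≠ 0) :
    IsJetC2 m u x₀ fun x => (f x)⁻¹ where
  contDiffAt := hf.contDiffAt.inv h0
  mem := inv_mem hf.mem h0
  pd_mem d := by
    have hi := inv_mem hf.mem h0
    refine congr_mem (fun_mul_mem (neg_mem (hf.pd_mem d)) (fun_mul_mem hi hi)) ?_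
    filter_upwards [hf.eventually_differentiableAt,
      hf.contDiffAt.continuousAt.eventually_ne h0] with x h1 h2
    exact pd_inv h1 h2 d

theorem sum {ι : Type*} (s : Finset ι) {f : ι → Pt n → ℝ}
    (hf : ∀ i ∈ s, IsJetC2 m u x₀ (f i)) : IsJetC2 m u x₀ fun x => ∑ i ∈ s, f i x where
  contDiffAt := ContDiffAt.sum fun i hi => (hf i hi).contDiffAt
  mem := fun_sum_mem s fun i hi => (hf i hi).mem
  pd_mem d := by
    refine congr_mem (fun_sum_mem s fun i hi => (hf i hi).pd_mem d) ?_
    filter_upwards [(Filter.eventually_all_finset s).mpr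
      fun i hi => (hf i hi).eventually_differentiableAt] with x hx
    exact pd_sum s hx d

/-- Modulo the jet ring, second derivatives obey the Leibniz rule of a derivation. -/
theorem pd_pd_mul_sub_mem {f g : Pt n → ℝ} (hf : IsJetC2 m u x₀ f) (hg : IsJetC2 m u x₀ g)
    (d e : Fin n) :
    (fun x => pd e (pd d fun y => f y * g y) x -
      (pd e (pd d f) x * g x + f x * pd e (pd d g) x)) ∈ jetRing m u x₀ := by
  refine congr_mem (fun_add_mem (fun_mul_mem (hf.pd_mem d) (hg.pd_mem e))
      (fun_mul_mem (hf.pd_mem e) (hg.pd_mem d))) ?_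
  filter_upwards [hf.contDiffAt.eventually (by simp), hg.contDiffAt.eventually (by simp)]
    with x h1 h2
  rw [pd_pd_mul h1 h2]
  ring

end IsJetC2

end JetRing

section Prolongation

/-- Solving the prolonged conformal Killing-type system: the symmetric array `C` is determined by
the remainder `L`. -/
theorem conformal_hessian_eq {n : ℕ} (hn : 3 ≤ n) {g G : Matrix (Fin n) (Fin n) ℝ}
    (hg : g.IsSymm) (hG : G * g = 1) {C : Fin n → Fin n → ℝ}
    (hC : ∀ i j, C i j = C j i)
    {K : Fin n → Fin n → Fin n → Fin n → ℝ}
    (hK : ∀ a d e b, K a d e b =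
      C a e * g d b - C b e * g a d - C a d * g e b + C b d * g a e) (a e : Fin n) :
    C a e = ((n : ℝ) - 2)⁻¹ * ((∑ d, ∑ b, G d b * K a d e b) -
      (2 * (n : ℝ) - 2)⁻¹ * (∑ a', ∑ e', G a' e' * ∑ d, ∑ b, G d b * K a' d e' b) * g a e) := by
  have hG' : ∀ i j, ∑ k, G i k * g k j = (1 : Matrix (Fin n) (Fin n) ℝ) i j := by
    intro i j; rw [← hG, Matrix.mul_apply]
  have hgG : g * G = 1 := mul_eq_one_comm.mp hG
  have hgG' : ∀ i j, ∑ k, g i k * G k j = (1 : Matrix (Fin n) (Fin n) ℝ) i j := by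
    intro i j; rw [← hgG, Matrix.mul_apply]
  have hs : ∀ i j, g i j = g j i := fun i j => hg.apply j i
  have htr : ∑ d, ∑ b, G d b * g d b = n := by
    have : ∀ d, ∑ b, G d b * g d b = 1 := by
      intro d
      simp_rw [hs d, hG' d d, Matrix.one_apply_eq]
    simp [this]
  set tr := ∑ d, ∑ b, G d b * C b d with htrdef
  have htr' : ∑ d, ∑ b, G d b * C d b = tr :=
    Finset.sum_congr rfl fun d _ => Finset.sum_congr rfl fun b _ => by rw [hC d b]
  have hK1 : ∀ a e, ∑ d, ∑ b, G d b * K a d e b = ((n : ℝ) - 2) * C a e + tr * g a e := by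
    intro a e
    have h1 : ∑ d, ∑ b, G d b * (C a e * g d b) = n * C a e := by
      rw [← htr, Finset.sum_mul]
      refine Finset.sum_congr rfl fun d _ => ?_
      rw [Finset.sum_mul]
      exact Finset.sum_congr rfl fun b _ => by ring
    have h2 : ∑ d, ∑ b, G d b * (C b e * g a d) = C a e := by
      rw [Finset.sum_comm]
      have : ∀ b, ∑ d, G d b * (C b e * g a d) = (1 : Matrix (Fin n) (Fin n) ℝ) a b * C b e := by
        intro b
        rw [← hgG', Finset.sum_mul]
        exact Finset.sum_congr rfl fun d _ => by ring
      simp [this, Matrix.one_apply]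
    have h3 : ∑ d, ∑ b, G d b * (C a d * g e b) = C a e := by
      have : ∀ d, ∑ b, G d b * (C a d * g e b) = (1 : Matrix (Fin n) (Fin n) ℝ) d e * C a d := by
        intro d
        rw [← hG', Finset.sum_mul]
        exact Finset.sum_congr rfl fun b _ => by rw [hs e b]; ring
      simp [this, Matrix.one_apply]
    have h4 : ∑ d, ∑ b, G d b * (C b d * g a e) = tr * g a e := by
      rw [htrdef, Finset.sum_mul]
      refine Finset.sum_congr rfl fun d _ => ?_
      rw [Finset.sum_mul]
      exact Finset.sum_congr rfl fun b _ => by ring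
    simp only [hK, mul_add, mul_sub, Finset.sum_add_distrib, Finset.sum_sub_distrib, h1, h2, h3,
      h4]
    ring
  have hn3 : (3 : ℝ) ≤ n := by exact_mod_cast hn
  have hC2 : ∑ a', ∑ e', G a' e' * (((n : ℝ) - 2) * C a' e' + tr * g a' e') =
      (2 * (n : ℝ) - 2) * tr := by
    have : ∀ a' e', G a' e' * (((n : ℝ) - 2) * C a' e' + tr * g a' e') =
        ((n : ℝ) - 2) * (G a' e' * C a' e') + tr * (G a' e' * g a' e') := fun _ _ => by ring
    simp only [this, Finset.sum_add_distrib, ← Finset.mul_sum, htr, htr']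
    ring
  simp only [hK1, hC2]
  have h2 : (n : ℝ) - 2 ≠ 0 := by linarith
  have h3 : 2 * (n : ℝ) - 2 ≠ 0 := by linarith
  rw [inv_mul_cancel_left₀ h3, add_sub_cancel_right, inv_mul_cancel_left₀ h2]

open jetRing in
/-- If the polarized third derivatives `r` satisfy the twice differentiated conformality equation
modulo the jet ring, then they belong to the jet ring. -/
theorem mem_jetRing_of_prolongation {n : ℕ} (hn : 3 ≤ n) {X : Type*} [NormedAddCommGroup X]
    [NormedSpace ℝ X] {m : WithTop ℕ∞} {u : Pt n → X} {x₀ : Pt n}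
    {g W : Pt n → Matrix (Fin n) (Fin n) ℝ} {C : Fin n → Fin n → Pt n → ℝ}
    {r : Fin n → Fin n → Fin n → Fin n → Pt n → ℝ}
    (hg : ∀ a b, (fun x => g x a b) ∈ jetRing m u x₀)
    (hW : ∀ a b, (fun x => W x a b) ∈ jetRing m u x₀)
    (hgs : ∀ᶠ x in 𝓝 x₀, (g x).IsSymm)
    (hgu : ∀ᶠ x in 𝓝 x₀, IsUnit (g x).det) (hWu : ∀ᶠ x in 𝓝 x₀, IsUnit (W x).det)
    (hC : ∀ᶠ x in 𝓝 x₀, ∀ d e, C d e x = C e d x)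
    (hr₁ : ∀ᶠ x in 𝓝 x₀, ∀ i a d e, r i a d e x = r i d a e x)
    (hr₂ : ∀ᶠ x in 𝓝 x₀, ∀ i a d e, r i a d e x = r i a e d x)
    (hL : ∀ a b d e, (fun x => ((∑ i, r i a d e x * W x i b) + ∑ i, r i b d e x * W x i a) -
      C d e x * g x a b) ∈ jetRing m u x₀) (i a d e : Fin n) :
    r i a d e ∈ jetRing m u x₀ := by
  let T : Fin n → Fin n → Fin n → Fin n → Pt n → ℝ := fun a d e b x => ∑ i, r i a d e x * W x i b
  let L : Fin n → Fin n → Fin n → Fin n → Pt n → ℝ := fun a b d e x =>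
    (T a d e b x + T b d e a x) - C d e x * g x a b
  let Λ : Fin n → Fin n → Fin n → Fin n → Pt n → ℝ := fun a d e b x =>
    (L a b d e x + L d b a e x) - L a d b e x
  let K : Fin n → Fin n → Fin n → Fin n → Pt n → ℝ := fun a d e b x =>
    Λ a e d b x - Λ a d e b x
  have hL' : ∀ a b d e, L a b d e ∈ jetRing m u x₀ := hL
  have hΛ : ∀ a d e b, Λ a d e b ∈ jetRing m u x₀ := fun a d e b =>
    fun_sub_mem (fun_add_mem (hL' a b d e) (hL' d b a e)) (hL' a d b e)
  have hKm : ∀ a d e b, K a d e b ∈ jetRing m u x₀ := fun a d e b =>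
    fun_sub_mem (hΛ a e d b) (hΛ a d e b)
  have hG : ∀ a b, (fun x => (g x)⁻¹ a b) ∈ jetRing m u x₀ :=
    matrix_inv_mem hg hgu.self_of_nhds.ne_zero
  have hT : ∀ᶠ x in 𝓝 x₀, ∀ a d e b, T a d e b x = T d a e b x ∧ T a d e b x = T a e d b x := by
    filter_upwards [hr₁, hr₂] with x h1 h2 a d e b
    exact ⟨Finset.sum_congr rfl fun i _ => by rw [h1], Finset.sum_congr rfl fun i _ => by rw [h2]⟩
  have hTeq : ∀ᶠ x in 𝓝 x₀, ∀ a d e b, 2 * T a d e b x =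
      C d e x * g x a b + C a e x * g x d b - C b e x * g x a d + Λ a d e b x := by
    filter_upwards [hT] with x h a d e b
    simp only [Λ, L]
    rw [(h b d e a).1, (h b a e d).1, (h d a e b).1]
    ring
  have hCm : ∀ a e, C a e ∈ jetRing m u x₀ := by
    intro a e
    have hK' : ∀ a e, (fun x => ∑ d, ∑ b, (g x)⁻¹ d b * K a d e b x) ∈ jetRing m u x₀ :=
      fun a e => fun_sum_mem _ fun d _ => fun_sum_mem _ fun b _ =>
        fun_mul_mem (hG d b) (hKm a d e b)
    have hK'' : (fun x => ∑ a', ∑ e', (g x)⁻¹ a' e' * ∑ d, ∑ b, (g x)⁻¹ d b * K a' d e' b x) ∈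
        jetRing m u x₀ :=
      fun_sum_mem _ fun d _ => fun_sum_mem _ fun b _ => fun_mul_mem (hG d b) (hK' d b)
    refine congr_mem (fun_mul_mem (const_mem (((n : ℝ) - 2)⁻¹)) (fun_sub_mem (hK' a e)
      (fun_mul_mem (fun_mul_mem (const_mem ((2 * (n : ℝ) - 2)⁻¹)) hK'') (hg a e)))) ?_
    filter_upwards [hgs, hgu, hC, hT, hTeq] with x hs hu hc ht hteq
    refine conformal_hessian_eq hn hs (Matrix.nonsing_inv_mul _ hu) (C := fun d e => C d e x)
      (K := fun a d e b => K a d e b x) hc ?_ a e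
    intro a d e b
    have h1 := hteq a d e b
    have h2 := hteq a e d b
    have h3 := (ht a d e b).2
    have h4 := hc d e
    simp only [K]
    rw [h4] at h1
    linarith
  have hTm : ∀ a d e b, T a d e b ∈ jetRing m u x₀ := by
    intro a d e b
    refine congr_mem (fun_mul_mem (const_mem (2⁻¹ : ℝ)) (fun_add_mem (fun_sub_mem (fun_add_mem
      (fun_mul_mem (hCm d e) (hg a b)) (fun_mul_mem (hCm a e) (hg d b)))
      (fun_mul_mem (hCm b e) (hg a d))) (hΛ a d e b))) ?_
    filter_upwards [hTeq] with x h
    linarith [h a d e b]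
  have hWi := matrix_inv_mem hW hWu.self_of_nhds.ne_zero
  refine congr_mem (fun_sum_mem Finset.univ fun b _ => fun_mul_mem (hTm a d e b) (hWi b i)) ?_
  filter_upwards [hWu] with x hx
  have h1 : (fun i => r i a d e x) ᵥ* W x = fun b => T a d e b x := rfl
  have h2 := congrFun (congrArg (· ᵥ* (W x)⁻¹) h1) i
  simp only [Matrix.vecMul_vecMul, Matrix.mul_nonsing_inv _ hx, Matrix.vecMul_one] at h2
  exact h2

end Prolongation

section ConformalJet

variable {n : ℕ}

/-- The target of the `2`-jet in coordinates of a map `ℝⁿ → ℝⁿ`. -/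
abbrev JetSpace (n : ℕ) := Pt n × (Fin n → Fin n → ℝ) × (Fin n → Fin n → Fin n → ℝ)

/-- The `2`-jet in coordinates of a map `ℝⁿ → ℝⁿ`. -/
def twoJet (F : Pt n → Pt n) (x : Pt n) : JetSpace n :=
  (F x, fun i a => pd a (fun y => F y i) x, fun i a b => pd b (pd a fun y => F y i) x)

namespace IsJetC2

open jetRing

variable {X : Type*} [NormedAddCommGroup X] [NormedSpace ℝ X] {m : WithTop ℕ∞} {u : Pt n → X}
  {x₀ : Pt n}

theorem pd_pd_mul_congr {f g Df Dg : Pt n → ℝ} (hf : IsJetC2 m u x₀ f) (hg : IsJetC2 m u x₀ g)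
    {d e : Fin n} (hDf : (fun x => pd e (pd d f) x - Df x) ∈ jetRing m u x₀)
    (hDg : (fun x => pd e (pd d g) x - Dg x) ∈ jetRing m u x₀) :
    (fun x => pd e (pd d fun y => f y * g y) x - (Df x * g x + f x * Dg x)) ∈
      jetRing m u x₀ := by
  refine congr_mem (fun_add_mem (hf.pd_pd_mul_sub_mem hg d e)
    (fun_add_mem (fun_mul_mem hDf hg.mem) (fun_mul_mem hf.mem hDg))) (.of_eq ?_)
  ext x
  ring

theorem pd_pd_sum_congr {ι : Type*} (s : Finset ι) {f Df : ι → Pt n → ℝ}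
    (hf : ∀ i ∈ s, IsJetC2 m u x₀ (f i)) {d e : Fin n}
    (hDf : ∀ i ∈ s, (fun x => pd e (pd d (f i)) x - Df i x) ∈ jetRing m u x₀) :
    (fun x => pd e (pd d fun y => ∑ i ∈ s, f i y) x - ∑ i ∈ s, Df i x) ∈ jetRing m u x₀ := by
  refine congr_mem (fun_sum_mem s hDf) ?_
  filter_upwards [(Filter.eventually_all_finset s).mpr
    fun i hi => (hf i hi).contDiffAt.eventually (by simp)] with x hx
  rw [pd_pd_sum s hx, Finset.sum_sub_distrib]

variable {F : Pt n → Pt n}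

theorem pd_coord (hF : ∀ i, ContDiffAt ℝ 3 (fun x => F x i) x₀) (i a : Fin n) :
    IsJetC2 m (twoJet F) x₀ (pd a fun y => F y i) where
  contDiffAt := contDiffAt_pd (hF i) (by norm_num) a
  mem := comp_mem (Ψ := fun z : Pt n × JetSpace n => z.2.2.1 i a) (by fun_prop)
  pd_mem d := comp_mem (Ψ := fun z : Pt n × JetSpace n => z.2.2.2 i a d) (by fun_prop)

theorem pd_comp_eventuallyEq (hF : ∀ i, ContDiffAt ℝ 3 (fun x => F x i) x₀) {K : Pt n → ℝ}
    (hK : ContDiffAt ℝ m K (F x₀)) (h2 : 2 ≤ m) (d : Fin n) :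
    pd d (fun x => K (F x)) =ᶠ[𝓝 x₀]
      fun x => ∑ l, pd l K (F x) * pd d (fun y => F y l) x := by
  have hF' : ContDiffAt ℝ 3 F x₀ := contDiffAt_pi.mpr hF
  filter_upwards [hF'.eventually (by simp), hF'.continuousAt.eventually
    ((hK.of_le h2).eventually (by simp))] with x h1 h2
  exact pd_comp (h2.differentiableAt (by simp)) (h1.differentiableAt (by simp)) d

theorem comp (hF : ∀ i, ContDiffAt ℝ 3 (fun x => F x i) x₀) (hm : m + 1 ≤ m) (h2 : 2 ≤ m)
    {K : Pt n → ℝ} (hK : ContDiffAt ℝ m K (F x₀)) :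
    IsJetC2 m (twoJet F) x₀ fun x => K (F x) := by
  have hmem : ∀ {K : Pt n → ℝ}, ContDiffAt ℝ m K (F x₀) →
      (fun x => K (F x)) ∈ jetRing m (twoJet F) x₀ := fun {K} hK =>
    comp_mem (Ψ := fun z : Pt n × JetSpace n => K z.2.1) (ContDiffAt.comp (g := K)
      (f := fun z : Pt n × JetSpace n => z.2.1) (x₀, twoJet F x₀) hK (by fun_prop))
  refine ⟨?_, hmem hK, fun d => ?_⟩
  · exact ContDiffAt.comp (g := K) x₀ (hK.of_le h2)
      ((contDiffAt_pi.mpr hF : ContDiffAt ℝ 3 F x₀).of_le (by norm_num))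
  · exact congr_mem (fun_sum_mem _ fun l _ => fun_mul_mem (hmem (contDiffAt_pd hK hm l))
      (pd_coord hF l d).mem) (pd_comp_eventuallyEq hF hK h2 d)

theorem pd_pd_comp_mem (hF : ∀ i, ContDiffAt ℝ 3 (fun x => F x i) x₀) (hm : m + 1 ≤ m)
    (h2 : 2 ≤ m) {K : Pt n → ℝ} (hK : ContDiffAt ℝ m K (F x₀)) (d e : Fin n) :
    pd e (pd d fun x => K (F x)) ∈ jetRing m (twoJet F) x₀ := by
  refine congr_mem ?_ (pd_congr (pd_comp_eventuallyEq hF hK h2 d) e)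
  exact (IsJetC2.sum _ fun l _ =>
    (comp hF hm h2 (contDiffAt_pd hK hm l)).mul (pd_coord hF l d)).pd_mem e

end IsJetC2

open jetRing in
/-- The third derivatives of a `C³` conformal map are `C^m` expressions in its `2`-jet. -/
theorem pd_pd_pd_mem_jetRing_of_conformal (hn : 3 ≤ n) {m : WithTop ℕ∞} (hm : m + 1 ≤ m)
    (h2 : 2 ≤ m) {g h : Met n} {F : Pt n → Pt n} {c : Pt n → ℝ} {x₀ : Pt n}
    (hF : ∀ i, ContDiffAt ℝ 3 (fun x => F x i) x₀)
    (hg : ∀ a b, ContDiffAt ℝ m (fun x => g x a b) x₀)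
    (hh : ∀ a b, ContDiffAt ℝ m (fun x => h x a b) (F x₀))
    (hgm : ∀ᶠ x in 𝓝 x₀, (g x).IsSymm ∧ (g x).PosDef)
    (hhm : ∀ᶠ x in 𝓝 x₀, (h (F x)).IsSymm ∧ (h (F x)).PosDef)
    (hJ : ∀ᶠ x in 𝓝 x₀, IsUnit (jac F x))
    (hconf : ∀ᶠ x in 𝓝 x₀, (jac F x)ᵀ * h (F x) * jac F x = c x • g x) (i a d e : Fin n) :
    pd e (pd d (pd a fun y => F y i)) ∈ jetRing m (twoJet F) x₀ := by
  let p : Fin n → Fin n → Pt n → ℝ := fun i a => pd a fun y => F y i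
  let r : Fin n → Fin n → Fin n → Fin n → Pt n → ℝ := fun i a d e => pd e (pd d (p i a))
  let H : Fin n → Fin n → Pt n → ℝ := fun i j x => h (F x) i j
  let N : Fin n → Fin n → Pt n → ℝ := fun a b x => ∑ i, ∑ j, p i a x * (H i j x * p j b x)
  let o : Fin n := ⟨0, by omega⟩
  let k : Pt n → ℝ := fun x => N o o x * (g x o o)⁻¹
  have hp : ∀ i a, IsJetC2 m (twoJet F) x₀ (p i a) := IsJetC2.pd_coord hF
  have hH : ∀ i j, IsJetC2 m (twoJet F) x₀ (H i j) := fun i j => .comp hF hm h2 (hh i j)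
  have hgJ : ∀ a b, IsJetC2 m (twoJet F) x₀ fun x => g x a b := fun a b =>
    .of_contDiffAt (hg a b) hm h2
  have hN : ∀ a b, IsJetC2 m (twoJet F) x₀ (N a b) := fun a b =>
    .sum _ fun i _ => .sum _ fun j _ => (hp i a).mul ((hH i j).mul (hp j b))
  have hgo : ∀ᶠ x in 𝓝 x₀, g x o o ≠ 0 := hgm.mono fun x hx => hx.2.diag_pos.ne'
  have hk : IsJetC2 m (twoJet F) x₀ k := (hN o o).mul ((hgJ o o).inv hgo.self_of_nhds)
  have hNc : ∀ᶠ x in 𝓝 x₀, ∀ a b, N a b x = c x * g x a b := by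
    filter_upwards [hconf] with x hx a b
    have := congrFun (congrFun hx a) b
    rw [Matrix.smul_apply, smul_eq_mul] at this
    rw [← this, Matrix.mul_assoc, Matrix.mul_apply]
    refine Finset.sum_congr rfl fun i _ => ?_
    rw [Matrix.mul_apply, Finset.mul_sum]
    rfl
  have hNk : ∀ a b, N a b =ᶠ[𝓝 x₀] fun x => k x * g x a b := by
    intro a b
    filter_upwards [hNc, hgo] with x hx hx0
    simp only [k]
    rw [hx a b, hx o o, mul_inv_cancel_right₀ hx0]
  have hDp : ∀ i a d e, (fun x => pd e (pd d (p i a)) x - r i a d e x) ∈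
      jetRing m (twoJet F) x₀ := by
    intro i a d e
    simpa only [r, sub_self] using const_mem 0
  have hDH : ∀ i j d e, (fun x => pd e (pd d (H i j)) x - (0 : Pt n → ℝ) x) ∈
      jetRing m (twoJet F) x₀ := by
    intro i j d e
    simpa only [Pi.zero_apply, sub_zero] using IsJetC2.pd_pd_comp_mem hF hm h2 (hh i j) d e
  have hDg : ∀ a b d e, (fun x => pd e (pd d fun y => g y a b) x - (0 : Pt n → ℝ) x) ∈
      jetRing m (twoJet F) x₀ := by
    intro a b d e
    simpa only [Pi.zero_apply, sub_zero] using
      jetRing.of_contDiffAt (contDiffAt_pd (contDiffAt_pd (hg a b) hm d) hm e)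
  have hDk : ∀ d e, (fun x => pd e (pd d k) x - pd e (pd d k) x) ∈ jetRing m (twoJet F) x₀ := by
    intro d e
    simpa only [sub_self] using const_mem 0
  have hDN := fun a b d e => IsJetC2.pd_pd_sum_congr Finset.univ
    (fun i _ => .sum _ fun j _ => (hp i a).mul ((hH i j).mul (hp j b)))
    (fun i _ => IsJetC2.pd_pd_sum_congr Finset.univ
      (fun j _ => (hp i a).mul ((hH i j).mul (hp j b)))
      (fun j _ => (hp i a).pd_pd_mul_congr ((hH i j).mul (hp j b)) (hDp i a d e)
        ((hH i j).pd_pd_mul_congr (hp j b) (hDH i j d e) (hDp j b d e))))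
  have hDkg := fun a b d e => hk.pd_pd_mul_congr (hgJ a b) (hDk d e) (hDg a b d e)
  refine mem_jetRing_of_prolongation hn (g := g) (W := fun x => h (F x) * jac F x)
    (C := fun d e => pd e (pd d k)) (r := r) (fun a b => (hgJ a b).mem) ?_
    (hgm.mono fun x hx => hx.1) (hgm.mono fun x hx => hx.2.det_pos.ne'.isUnit) ?_ ?_ ?_ ?_ ?_
    i a d e
  · intro i b
    simp only [Matrix.mul_apply]
    exact fun_sum_mem _ fun j _ => fun_mul_mem (hH i j).mem (hp j b).mem
  · filter_upwards [hhm, hJ] with x h1 h2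
    rw [Matrix.det_mul]
    exact h1.2.det_pos.ne'.isUnit.mul ((Matrix.isUnit_iff_isUnit_det _).mp h2)
  · filter_upwards [hk.contDiffAt.eventually (by simp)] with x hx d e
    exact pd_comm hx e d
  · simp only [Filter.eventually_all]
    intro i a d e
    refine pd_congr ?_ e
    filter_upwards [(hF i).eventually (by simp)] with x hx
    exact pd_comm (hx.of_le (by norm_num)) d a
  · simp only [Filter.eventually_all]
    intro i a d e
    filter_upwards [(hp i a).contDiffAt.eventually (by simp)] with x hx
    exact pd_comm hx e d
  · intro a b d e
    refine congr_mem (fun_sub_mem (hDkg a b d e) (hDN a b d e)) ?_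
    filter_upwards [hhm, (pd_congr (pd_congr (hNk a b) d) e)] with x hx hNx
    have hs : ∀ i j, H i j x = H j i x := fun i j => hx.1.apply j i
    have h1 : ∑ i, r i a d e x * (h (F x) * jac F x) i b =
        ∑ i, ∑ j, r i a d e x * (H i j x * p j b x) :=
      Finset.sum_congr rfl fun i _ => by rw [Matrix.mul_apply, Finset.mul_sum]; rfl
    have h2 : ∑ i, r i b d e x * (h (F x) * jac F x) i a =
        ∑ i, ∑ j, p i a x * (H i j x * r j b d e x) := by
      rw [Finset.sum_comm]
      refine Finset.sum_congr rfl fun i _ => ?_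
      rw [Matrix.mul_apply, Finset.mul_sum]
      refine Finset.sum_congr rfl fun j _ => ?_
      change r i b d e x * (H i j x * p j a x) = _
      rw [hs i j]
      ring
    change _ = _ - (pd e (pd d (N a b)) x - _)
    rw [hNx, h1, h2]
    simp only [Pi.zero_apply, zero_mul, mul_zero, zero_add, add_zero, Finset.sum_add_distrib]
    ring

theorem hasFDerivAt_sum_pd {f : Pt n → ℝ} {x : Pt n} (hf : DifferentiableAt ℝ f x) :
    HasFDerivAt f (∑ d, pd d f x • ContinuousLinearMap.proj (R := ℝ) (φ := fun _ => ℝ) d) x := by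
  refine hf.hasFDerivAt.congr_fderiv (ContinuousLinearMap.ext fun v => ?_)
  conv_lhs => rw [pi_eq_sum_univ' v]
  simp [pd, mul_comm]

/-- If the third derivatives of a `C³` map are smooth or analytic expressions in its `2`-jet, then
the map is smooth, respectively analytic. -/
theorem contDiffAt_of_pd_pd_pd_mem_jetRing {m : WithTop ℕ∞} (hm : m = ∞ ∨ m = ω)
    {F : Pt n → Pt n} {x₀ : Pt n} (hF : ∀ i, ContDiffAt ℝ 3 (fun x => F x i) x₀)
    (hr : ∀ i a d e, pd e (pd d (pd a fun y => F y i)) ∈ jetRing m (twoJet F) x₀) :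
    ContDiffAt ℝ m F x₀ := by
  choose R hR hRr using fun i a d e => mem_jetRing.mp (hr i a d e)
  let v : Fin n → Pt n × JetSpace n → JetSpace n := fun d z =>
    (fun i => z.2.2.1 i d, fun i a => z.2.2.2 i a d, fun i a b => R i a b d z)
  let Φ : Pt n × JetSpace n → Pt n →L[ℝ] JetSpace n := fun z =>
    ∑ d, (ContinuousLinearMap.proj (R := ℝ) (φ := fun _ => ℝ) d).smulRight (v d z)
  have hv : ∀ d, ContDiffAt ℝ m (v d) (x₀, twoJet F x₀) := by
    intro d
    refine ContDiffAt.prodMk (by fun_prop) (ContDiffAt.prodMk (by fun_prop) ?_)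
    simp only [contDiffAt_pi]
    exact fun i a b => hR i a b d
  have hΦ : ContDiffAt ℝ m Φ (x₀, twoJet F x₀) :=
    ContDiffAt.sum fun d _ => contDiffAt_const.smulRight (hv d)
  have hu : ∀ᶠ x in 𝓝 x₀, HasFDerivAt (twoJet F) (Φ (x, twoJet F x)) x := by
    have hF' := Filter.eventually_all.mpr fun i => (hF i).eventually (by simp)
    have hR' : ∀ᶠ x in 𝓝 x₀, ∀ i a d e,
        pd e (pd d (pd a fun y => F y i)) x = R i a d e (x, twoJet F x) := by
      simp only [Filter.eventually_all]
      exact hRr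
    filter_upwards [hF', hR'] with x hx hRx
    have h1 : ∀ i a, ContDiffAt ℝ 2 (pd a fun y => F y i) x := fun i a =>
      contDiffAt_pd (hx i) (by norm_num) a
    have h2 : ∀ i a b, ContDiffAt ℝ 1 (pd b (pd a fun y => F y i)) x := fun i a b =>
      contDiffAt_pd (h1 i a) (by norm_num) b
    refine HasFDerivAt.congr_fderiv ((hasFDerivAt_pi.mpr fun i =>
        hasFDerivAt_sum_pd ((hx i).differentiableAt (by simp))).prodMk
      ((hasFDerivAt_pi.mpr fun i => hasFDerivAt_pi.mpr fun a =>
        hasFDerivAt_sum_pd ((h1 i a).differentiableAt (by simp))).prodMk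
      (hasFDerivAt_pi.mpr fun i => hasFDerivAt_pi.mpr fun a => hasFDerivAt_pi.mpr fun b =>
        hasFDerivAt_sum_pd ((h2 i a b).differentiableAt (by simp))))) ?_
    refine ContinuousLinearMap.ext fun y => Prod.ext ?_ (Prod.ext ?_ ?_)
    · ext i
      simp [Φ, v, twoJet, Prod.fst_sum, mul_comm]
    · ext i a
      simp [Φ, v, twoJet, Prod.fst_sum, Prod.snd_sum, mul_comm]
    · ext i a b
      simp [Φ, v, hRx, Prod.snd_sum, mul_comm]
  have hjet : ContDiffAt ℝ m (twoJet F) x₀ := by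
    rcases hm with rfl | rfl
    · exact contDiffAt_infty_of_hasFDerivAt_eq hΦ hu
    · exact contDiffAt_omega_of_hasFDerivAt_eq hΦ hu
  exact hjet.fst

/-- Interior regularity of `C³` conformal maps, in the smooth and in the analytic class. -/
theorem contDiffAt_of_conformal (hn : 3 ≤ n) {m : WithTop ℕ∞} (hm : m = ∞ ∨ m = ω)
    {g h : Met n} {F : Pt n → Pt n} {c : Pt n → ℝ} {x₀ : Pt n}
    (hF : ∀ i, ContDiffAt ℝ 3 (fun x => F x i) x₀)
    (hg : ∀ a b, ContDiffAt ℝ m (fun x => g x a b) x₀)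
    (hh : ∀ a b, ContDiffAt ℝ m (fun x => h x a b) (F x₀))
    (hgm : ∀ᶠ x in 𝓝 x₀, (g x).IsSymm ∧ (g x).PosDef)
    (hhm : ∀ᶠ x in 𝓝 x₀, (h (F x)).IsSymm ∧ (h (F x)).PosDef)
    (hJ : ∀ᶠ x in 𝓝 x₀, IsUnit (jac F x))
    (hconf : ∀ᶠ x in 𝓝 x₀, (jac F x)ᵀ * h (F x) * jac F x = c x • g x) :
    ContDiffAt ℝ m F x₀ := by
  refine contDiffAt_of_pd_pd_pd_mem_jetRing hm hF
    (pd_pd_pd_mem_jetRing_of_conformal hn ?_ ?_ hF hg hh hgm hhm hJ hconf)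
  · rcases hm with rfl | rfl <;> exact le_rfl
  · rcases hm with rfl | rfl
    · exact WithTop.coe_le_coe.mpr (le_top : (2 : ℕ∞) ≤ ⊤)
    · exact le_top

/-- A continuous right inverse of a `C^m` map with invertible Jacobian is `C^m`. -/
theorem contDiffAt_of_rightInverse {m : WithTop ℕ∞} (hm : m ≠ 0) {F G : Pt n → Pt n} {y₀ : Pt n}
    (hF : ContDiffAt ℝ m F (G y₀)) (hJ : IsUnit (jac F (G y₀))) (hG : ContinuousAt G y₀)
    (hFG : ∀ᶠ y in 𝓝 y₀, F (G y) = y) : ContDiffAt ℝ m G y₀ := by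
  have hFd : DifferentiableAt ℝ F (G y₀) := hF.differentiableAt hm
  have hmv : ∀ v, fderiv ℝ F (G y₀) v = jac F (G y₀) *ᵥ v := by
    intro v
    ext i
    have h1 := hasFDerivAt_sum_pd (hasFDerivAt_pi'.mp hFd.hasFDerivAt i).differentiableAt
    have h2 := congrArg (· v) ((hasFDerivAt_pi'.mp hFd.hasFDerivAt i).unique h1)
    simpa [jac, Matrix.mulVec, dotProduct] using h2
  have hinj : Function.Injective (fderiv ℝ F (G y₀)) := by
    intro v w hvw
    rw [hmv, hmv] at hvw
    exact Matrix.mulVec_injective_of_isUnit hJ hvw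
  let e : Pt n ≃L[ℝ] Pt n :=
    (LinearEquiv.ofInjectiveEndo (fderiv ℝ F (G y₀)).toLinearMap hinj).toContinuousLinearEquiv
  have he : HasFDerivAt F (e : Pt n →L[ℝ] Pt n) (G y₀) :=
    hFd.hasFDerivAt.congr_fderiv (ContinuousLinearMap.ext fun v => rfl)
  have hs := hF.hasStrictFDerivAt' he hm
  have hloc := hF.to_localInverse he hm
  rw [hFG.self_of_nhds] at hloc
  refine hloc.congr_of_eventuallyEq ?_
  filter_upwards [hG.eventually hs.eventually_left_inverse, hFG] with y h1 h2
  rw [h2] at h1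
  exact h1.symm

end ConformalJet

/-- Theorem 3.2, smooth and real-analytic cases: regularity of conformal
mappings. -/
theorem conformal_map_regularity_smooth_analytic
    (n : ℕ) (hn : 3 ≤ n)
    (U V : Set (Pt n)) (hU : IsOpen U) (hV : IsOpen V)
    (g h : Met n) (hgm : IsMetricOn g U) (hhm : IsMetricOn h V)
    (F : Pt n → Pt n) (hFmaps : Set.MapsTo F U V)
    (hFreg : ∀ i, ContDiffOn ℝ 3 (fun x => F x i) U)
    (hFdiff : ∀ x ∈ U, IsUnit (jac F x))
    (c : Pt n → ℝ)
    (hconf : ∀ x ∈ U, (jac F x)ᵀ * h (F x) * jac F x = c x • g x) :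
    ((∀ a b, ContDiffOn ℝ (⊤ : ℕ∞) (fun x => g x a b) U) →
     (∀ a b, ContDiffOn ℝ (⊤ : ℕ∞) (fun y => h y a b) V) →
      ∀ i, ContDiffOn ℝ (⊤ : ℕ∞) (fun x => F x i) U) ∧
    ((∀ a b, AnalyticOnNhd ℝ (fun x => g x a b) U) →
     (∀ a b, AnalyticOnNhd ℝ (fun y => h y a b) V) →
      (∀ i, AnalyticOnNhd ℝ (fun x => F x i) U) ∧
      (∀ (W : Set (Pt n)) (G : Pt n → Pt n), IsOpen W →
        (∀ i, ContDiffOn ℝ 1 (fun y => G y i) W) → Set.MapsTo G W U →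
        (∀ y ∈ W, F (G y) = y) →
        ∀ i, AnalyticOnNhd ℝ (fun y => G y i) W)) := by
  have key : ∀ m : WithTop ℕ∞, m = ∞ ∨ m = ω →
      (∀ x ∈ U, ∀ a b, ContDiffAt ℝ m (fun x => g x a b) x) →
      (∀ y ∈ V, ∀ a b, ContDiffAt ℝ m (fun y => h y a b) y) →
      ∀ x ∈ U, ContDiffAt ℝ m F x := by
    intro m hm hg hh x hx
    have hUx : ∀ᶠ y in 𝓝 x, y ∈ U := hU.mem_nhds hx
    exact contDiffAt_of_conformal hn hm (fun i => (hFreg i).contDiffAt hUx) (hg x hx)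
      (hh _ (hFmaps hx)) (hUx.mono hgm) (hUx.mono fun y hy => hhm _ (hFmaps hy))
      (hUx.mono hFdiff) (hUx.mono hconf)
  refine ⟨fun hg hh i x hx => ?_, fun hg hh => ?_⟩
  · exact (contDiffAt_pi.mp (key ∞ (.inl rfl) (fun x hx a b => (hg a b).contDiffAt (hU.mem_nhds hx))
      (fun y hy a b => (hh a b).contDiffAt (hV.mem_nhds hy)) x hx) i).contDiffWithinAt
  · have hF := key ω (.inr rfl) (fun x hx a b => (hg a b x hx).contDiffAt)
      (fun y hy a b => (hh a b y hy).contDiffAt)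
    refine ⟨fun i x hx => (contDiffAt_pi.mp (hF x hx) i).analyticAt, ?_⟩
    intro W G hW hG hGmaps hFG i y hy
    have hWy := hW.mem_nhds hy
    have hGc : ContinuousAt G y :=
      continuousAt_pi.mpr fun i => ((hG i).contDiffAt hWy).continuousAt
    have := contDiffAt_of_rightInverse (by simp) (hF _ (hGmaps hy)) (hFdiff _ (hGmaps hy)) hGc
      (Filter.mem_of_superset hWy hFG)
    exact (contDiffAt_pi.mp this i).analyticAt
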